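/- arXiv:1105.3858 — 5 statements merged into one kernel-verified Lean document; each statement's English description precedes it below -/
import Mathlib

section
/- Suppose the elementary bound holds, i.e. the matrix M − L_* is positive semidefinite, where M is built from the averages h = ∫_Y (1/b), m = ∫_Y b, a_L = (∫_Y 1/a)^{-1}, c_L = a_L ∫_Y (c/a), d_L = ∫_Y (a + c²/a) − c_L²/a_L of measurable coefficient functions a, b, c on Y = [0,1]³ satisfying 0 < a̲ ≤ a(y) ≤ ā, 0 < b̲ ≤ b(y) ≤ b̄, |c(y)| ≤ c̄ a.e., and L_* is built from positive reals a_*, b_* and a real c_*. Then the effective coefficients satisfy the arithmetic–harmonic mean bounds (∫_Y 1/b)^{-1} ≤ b_* ≤ ∫_Y b, and the circle bound (c_* − c_L)² ≤ (a_* − a_L)(d_L − a_*). -/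
open MeasureTheory

/-- The common 6×6 shape of the tensors `L` appearing in the elementary bounds:
entries `M₁₁ = M₂₂ = p`, `M₃₃ = q`, `M₄₄ = M₅₅ = r`, `M₆₆ = s`,
`M₁₅ = M₅₁ = t`, `M₂₄ = M₄₂ = −t`, all other entries zero. -/
def Lmat6 (p q r s t : ℝ) : Matrix (Fin 6) (Fin 6) ℝ :=
  !![p, 0, 0, 0, t, 0;
     0, p, 0, -t, 0, 0;
     0, 0, q, 0, 0, 0;
     0, -t, 0, r, 0, 0;
     t, 0, 0, 0, r, 0;
     0, 0, 0, 0, 0, s]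

/-- The positivity conditions carried by the diagonal entries and the `(1, 5)` minor of a
positive semidefinite difference of two tensors of the shape `Lmat6`. -/
theorem Lmat6_sub_posSemidef {p q r s t p' q' r' s' t' : ℝ}
    (H : (Lmat6 p q r s t - Lmat6 p' q' r' s' t').PosSemidef) :
    p' ≤ p ∧ q' ≤ q ∧ s' ≤ s ∧ (t - t') ^ 2 ≤ (p - p') * (r - r') := by
  have h0 := H.diag_nonneg (i := 0)
  have h2 := H.diag_nonneg (i := 2)
  have h5 := H.diag_nonneg (i := 5)
  have hdet := (H.submatrix ![(0 : Fin 6), 4]).det_nonneg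
  rw [Matrix.det_fin_two] at hdet
  simp [Lmat6] at h0 h2 h5 hdet
  exact ⟨h0, h2, h5, by linarith⟩

/-- The `(1, 5)` minor condition, cleared of denominators, is the circle bound. -/
theorem circle_bound_of_minor {α δ γ a c : ℝ} (hα : 0 < α) (ha : 0 < a)
    (H : (γ / α - c / a) ^ 2 ≤ (1 / α - 1 / a) * (δ + γ ^ 2 / α - (a + c ^ 2 / a))) :
    (c - γ) ^ 2 ≤ (a - α) * (δ - a) := by
  have key : (a - α) * (δ - a) - (c - γ) ^ 2 = α * a *
      ((1 / α - 1 / a) * (δ + γ ^ 2 / α - (a + c ^ 2 / a)) - (γ / α - c / a) ^ 2) := by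
    field_simp
    ring
  have := mul_nonneg (mul_pos hα ha).le (sub_nonneg.mpr H)
  linarith

theorem stmt_0
    (a b c : (Fin 3 → ℝ) → ℝ)
    (ha_meas : Measurable a) (hb_meas : Measurable b) (hc_meas : Measurable c)
    (alow ahigh blow bhigh cbar : ℝ)
    (halow : 0 < alow) (hblow : 0 < blow)
    (Y : Set (Fin 3 → ℝ)) (hY : Y = Set.Icc 0 1)
    (ha : ∀ᵐ y ∂(volume.restrict Y), alow ≤ a y ∧ a y ≤ ahigh)
    (hb : ∀ᵐ y ∂(volume.restrict Y), blow ≤ b y ∧ b y ≤ bhigh)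
    (hc : ∀ᵐ y ∂(volume.restrict Y), |c y| ≤ cbar)
    (h m aL cL dL astar bstar cstar : ℝ)
    (hh : h = ∫ y in Y, 1 / b y)
    (hm : m = ∫ y in Y, b y)
    (haL : aL = (∫ y in Y, 1 / a y)⁻¹)
    (hcL : cL = aL * ∫ y in Y, c y / a y)
    (hdL : dL = (∫ y in Y, (a y + (c y) ^ 2 / a y)) - cL ^ 2 / aL)
    (hastar : 0 < astar) (hbstar : 0 < bstar)
    (hPSD : (Lmat6 (1 / aL) h (dL + cL ^ 2 / aL) m (cL / aL)
        - Lmat6 (1 / astar) (1 / bstar) (astar + cstar ^ 2 / astar) bstar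
            (cstar / astar)).PosSemidef) :
    (∫ y in Y, 1 / b y)⁻¹ ≤ bstar ∧ bstar ≤ ∫ y in Y, b y ∧
      (cstar - cL) ^ 2 ≤ (astar - aL) * (dL - astar) := by
  obtain ⟨hp, hq, hs, hminor⟩ := Lmat6_sub_posSemidef hPSD
  have haL_pos : 0 < aL := one_div_pos.mp ((one_div_pos.mpr hastar).trans_le hp)
  rw [← hh, ← hm]
  refine ⟨?_, hs, circle_bound_of_minor haL_pos hastar hminor⟩
  rw [one_div] at hq
  exact inv_le_of_inv_le₀ hbstar hq
end

section
/- For every κ > 0 there exists θ₀ > 0 such that for every θ ∈ (0, θ₀) the linear system (i)–(v) with σ³ = 2I + J has a unique solution (E¹_{θ,κ}, E²_{θ,κ}, E³_{θ,κ}, η₁, η₂), and the limit as θ → 0⁺ of the matrix (θ/2) (E³_{θ,κ})ᵀ J E³_{θ,κ} equals −(κ/17) J. -/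
open Matrix

noncomputable section

/-- The matrix `J` with `J₁₂ = -1`, `J₂₁ = 1`, all other entries `0`. -/
def Jmat : Matrix (Fin 3) (Fin 3) ℝ := !![0, -1, 0; 1, 0, 0; 0, 0, 0]

/-- The lamination direction `ξ¹_θ = (0, θ/√(1+θ²), 1/√(1+θ²))`. -/
def xi1 (θ : ℝ) : Fin 3 → ℝ :=
  ![0, θ / Real.sqrt (1 + θ ^ 2), 1 / Real.sqrt (1 + θ ^ 2)]

/-- The lamination direction `ξ² = (0, 1/√2, 1/√2)`. -/
def xi2 : Fin 3 → ℝ := ![0, 1 / Real.sqrt 2, 1 / Real.sqrt 2]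

/-- The phase `σ¹_{θ,κ} = diag(κθ⁻², κθ⁻², 1)`. -/
def sig1 (θ κ : ℝ) : Matrix (Fin 3) (Fin 3) ℝ :=
  !![κ / θ ^ 2, 0, 0; 0, κ / θ ^ 2, 0; 0, 0, 1]

/-- The phase `σ² = I`. -/
def sig2 : Matrix (Fin 3) (Fin 3) ℝ := 1

/-- The phase `σ³ = 2I + J`. -/
def sig3 : Matrix (Fin 3) (Fin 3) ℝ := (2 : ℝ) • 1 + Jmat

/-- The linear system (i)–(v) determining the electric fields of the rank-two laminate. -/
def LamSys (θ κ : ℝ) (σ3 : Matrix (Fin 3) (Fin 3) ℝ)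
    (E1 E2 E3 : Matrix (Fin 3) (Fin 3) ℝ) (η1 η2 : Fin 3 → ℝ) : Prop :=
  (1 - θ) • E1 + (θ / 2) • (E2 + E3) = 1 ∧
  E2 - E3 = vecMulVec xi2 η2 ∧
  E1 - (1 / 2 : ℝ) • (E2 + E3) = vecMulVec (xi1 θ) η1 ∧
  (sig2 * E2 - σ3 * E3)ᵀ *ᵥ xi2 = 0 ∧
  (sig1 θ κ * E1 - (1 / 2 : ℝ) • (sig2 * E2 + σ3 * E3))ᵀ *ᵥ xi1 θ = 0

open Filter Topology

lemma xi1_eq_smul (θ : ℝ) : xi1 θ = (1 / √(1 + θ ^ 2)) • ![0, θ, 1] := by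
  ext i; fin_cases i <;> simp [xi1]; ring

lemma xi2_eq_smul : xi2 = (1 / √2) • ![0, 1, 1] := by
  ext i; fin_cases i <;> simp [xi2]

/-- The field in the first phase, with rescaled amplitude `p`. -/
def field1 (θ : ℝ) (p : Fin 3 → ℝ) : Matrix (Fin 3) (Fin 3) ℝ :=
  1 + θ • vecMulVec ![0, θ, 1] p

/-- The field in the second phase (`q`) or the third phase (`-q`), with rescaled amplitudes. -/
def field2 (θ : ℝ) (p q : Fin 3 → ℝ) : Matrix (Fin 3) (Fin 3) ℝ :=
  1 - (1 - θ) • vecMulVec ![0, θ, 1] p + vecMulVec ![0, 1, 1] q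

lemma field1_eq (θ : ℝ) (p : Fin 3 → ℝ) :
    field1 θ p = !![1, 0, 0; θ * (θ * p 0), 1 + θ * (θ * p 1), θ * (θ * p 2);
      θ * p 0, θ * p 1, 1 + θ * p 2] := by
  ext i j
  rw [field1, Matrix.add_apply, Matrix.smul_apply, vecMulVec_apply]
  fin_cases i <;> fin_cases j <;> simp

lemma field2_eq (θ : ℝ) (p q : Fin 3 → ℝ) :
    field2 θ p q = !![1, 0, 0;
      -((1 - θ) * (θ * p 0)) + q 0, 1 - (1 - θ) * (θ * p 1) + q 1, -((1 - θ) * (θ * p 2)) + q 2;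
      -((1 - θ) * p 0) + q 0, -((1 - θ) * p 1) + q 1, 1 - (1 - θ) * p 2 + q 2] := by
  ext i j
  rw [field2, Matrix.add_apply, Matrix.sub_apply, Matrix.smul_apply, vecMulVec_apply,
    vecMulVec_apply]
  fin_cases i <;> fin_cases j <;> simp

/-- The right-hand side of the reduced flux condition across the layers of direction `ξ¹`. -/
def fluxRhs (θ κ : ℝ) : Fin 3 → ℝ := ![θ / 2, 3 / 2 * θ - κ / θ, 1 / 2]

/-- The first three equations determine the fields in terms of the amplitudes. -/
lemma field_equations_iff (θ : ℝ) (E1 E2 E3 : Matrix (Fin 3) (Fin 3) ℝ) (η1 η2 : Fin 3 → ℝ) :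
    ((1 - θ) • E1 + (θ / 2) • (E2 + E3) = 1 ∧ E2 - E3 = vecMulVec xi2 η2 ∧
      E1 - (1 / 2 : ℝ) • (E2 + E3) = vecMulVec (xi1 θ) η1) ↔
    E1 = field1 θ ((1 / √(1 + θ ^ 2)) • η1) ∧
      E2 = field2 θ ((1 / √(1 + θ ^ 2)) • η1) ((1 / (2 * √2)) • η2) ∧
      E3 = field2 θ ((1 / √(1 + θ ^ 2)) • η1) (-((1 / (2 * √2)) • η2)) := by
  have h1 : vecMulVec (xi1 θ) η1 = vecMulVec ![0, θ, 1] ((1 / √(1 + θ ^ 2)) • η1) := by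
    rw [xi1_eq_smul, smul_vecMulVec, vecMulVec_smul]
  have h2 : vecMulVec xi2 η2 = (2 : ℝ) • vecMulVec ![0, 1, 1] ((1 / (2 * √2)) • η2) := by
    rw [xi2_eq_smul, smul_vecMulVec, vecMulVec_smul, smul_smul]
    congr 1
    field_simp
  rw [h1, h2]
  simp only [field1, field2, vecMulVec_neg]
  generalize vecMulVec ![0, θ, 1] ((1 / √(1 + θ ^ 2)) • η1) = A
  generalize vecMulVec ![0, 1, 1] ((1 / (2 * √2)) • η2) = B
  constructor
  · rintro ⟨a, b, c⟩
    have e1 : E1 = 1 + θ • A := by rw [← a, ← c]; module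
    have e2 : (1 / 2 : ℝ) • (E2 + E3) = 1 - (1 - θ) • A := by
      rw [← a, ← c]; module
    have e3 : (1 / 2 : ℝ) • (E2 - E3) = B := by rw [b]; module
    refine ⟨e1, ?_, ?_⟩
    · rw [← e2, ← e3]; module
    · rw [← e2, ← e3]; module
  · rintro ⟨rfl, rfl, rfl⟩
    refine ⟨?_, ?_, ?_⟩ <;> module

lemma flux2_iff (θ : ℝ) (p q : Fin 3 → ℝ) :
    (sig2 * field2 θ p q - sig3 * field2 θ p (-q))ᵀ *ᵥ xi2 = 0 ↔
      ∀ j, (1 - θ ^ 2) * p j + 6 * q j = 1 := by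
  rw [xi2_eq_smul, mulVec_smul, smul_eq_zero_iff_right (by positivity), funext_iff]
  refine forall_congr' fun j => ?_
  rw [← sub_eq_zero (b := (1 : ℝ))]
  refine Eq.congr ?_ rfl
  fin_cases j <;>
  · simp [mulVec, dotProduct, sig2, sig3, field2_eq, Jmat, Matrix.mul_apply,
      Fin.sum_univ_three, Matrix.one_apply, -cons_mul]
    ring

lemma flux1_iff {θ : ℝ} (hθ : 0 < θ) (κ : ℝ) (p q : Fin 3 → ℝ) :
    (sig1 θ κ * field1 θ p -
      (1 / 2 : ℝ) • (sig2 * field2 θ p q + sig3 * field2 θ p (-q)))ᵀ *ᵥ xi1 θ = 0 ↔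
      ∀ j, ((κ + 1) * θ + 3 / 2 * (1 - θ) * (1 + θ ^ 2)) * p j + (1 + θ) / 2 * q j =
        fluxRhs θ κ j := by
  rw [xi1_eq_smul, mulVec_smul, smul_eq_zero_iff_right (by positivity), funext_iff]
  refine forall_congr' fun j => ?_
  rw [← sub_eq_zero (b := fluxRhs θ κ j)]
  refine Eq.congr ?_ rfl
  fin_cases j <;>
  · simp [mulVec, dotProduct, sig1, sig2, sig3, field1_eq, field2_eq, Jmat,
      Matrix.mul_apply, Fin.sum_univ_three, Matrix.one_apply, fluxRhs, -cons_mul]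
    field_simp
    ring

/-- The determinant of the reduced system, up to the factor `-2`. -/
def redDet (θ κ : ℝ) : ℝ :=
  12 * (κ + 1) * θ + (1 - θ) * (18 * (1 + θ ^ 2) - (1 + θ) ^ 2)

lemma redDet_pos {θ κ : ℝ} (hκ : 0 < κ) (h0 : 0 < θ) (h1 : θ < 1) : 0 < redDet θ κ := by
  have : 0 < 18 * (1 + θ ^ 2) - (1 + θ) ^ 2 := by nlinarith [sq_nonneg (θ - 1)]
  have : 0 < 1 - θ := by linarith
  unfold redDet
  positivity

/-- The solution `p` of the reduced system. -/
def ampP (θ κ : ℝ) (j : Fin 3) : ℝ := (12 * fluxRhs θ κ j - (1 + θ)) / redDet θ κ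

/-- The solution `q` of the reduced system. -/
def ampQ (θ κ : ℝ) (j : Fin 3) : ℝ := (1 - (1 - θ ^ 2) * ampP θ κ j) / 6

lemma reduced_iff {θ κ : ℝ} (hN : redDet θ κ ≠ 0) (p q : Fin 3 → ℝ) :
    ((∀ j, (1 - θ ^ 2) * p j + 6 * q j = 1) ∧
      ∀ j, ((κ + 1) * θ + 3 / 2 * (1 - θ) * (1 + θ ^ 2)) * p j + (1 + θ) / 2 * q j =
        fluxRhs θ κ j) ↔ p = ampP θ κ ∧ q = ampQ θ κ := by
  constructor
  · rintro ⟨h, h'⟩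
    have hp : p = ampP θ κ := by
      ext j
      rw [ampP, eq_div_iff hN, redDet]
      linear_combination 12 * h' j - (1 + θ) * h j
    subst hp
    refine ⟨rfl, ?_⟩
    ext j
    rw [ampQ]
    linear_combination h j / 6
  · rintro ⟨rfl, rfl⟩
    refine ⟨fun j => by rw [ampQ]; ring, fun j => ?_⟩
    have hP : ampP θ κ j * redDet θ κ = 12 * fluxRhs θ κ j - (1 + θ) := by
      rw [ampP, div_mul_cancel₀ _ hN]
    rw [redDet] at hP
    rw [ampQ]
    linear_combination hP / 12

lemma lamSys_iff {θ κ : ℝ} (hθ : 0 < θ) (hN : redDet θ κ ≠ 0)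
    (E1 E2 E3 : Matrix (Fin 3) (Fin 3) ℝ) (η1 η2 : Fin 3 → ℝ) :
    LamSys θ κ sig3 E1 E2 E3 η1 η2 ↔
      E1 = field1 θ (ampP θ κ) ∧ E2 = field2 θ (ampP θ κ) (ampQ θ κ) ∧
      E3 = field2 θ (ampP θ κ) (-ampQ θ κ) ∧
      η1 = √(1 + θ ^ 2) • ampP θ κ ∧ η2 = (2 * √2) • ampQ θ κ := by
  have hs : √(1 + θ ^ 2) ≠ 0 := by positivity
  have hr : 2 * √2 ≠ 0 := by positivity
  have e1 : η1 = √(1 + θ ^ 2) • ampP θ κ ↔ (1 / √(1 + θ ^ 2)) • η1 = ampP θ κ := by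
    rw [one_div, inv_smul_eq_iff₀ hs]
  have e2 : η2 = (2 * √2) • ampQ θ κ ↔ (1 / (2 * √2)) • η2 = ampQ θ κ := by
    rw [one_div, inv_smul_eq_iff₀ hr]
  rw [e1, e2]
  have key := field_equations_iff θ E1 E2 E3 η1 η2
  generalize (1 / √(1 + θ ^ 2)) • η1 = p at *
  generalize (1 / (2 * √2)) • η2 = q at *
  constructor
  · rintro ⟨a, b, c, d, e⟩
    obtain ⟨rfl, rfl, rfl⟩ := key.1 ⟨a, b, c⟩
    obtain ⟨rfl, rfl⟩ := (reduced_iff hN p q).1 ⟨(flux2_iff θ p q).1 d, (flux1_iff hθ κ p q).1 e⟩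
    exact ⟨rfl, rfl, rfl, rfl, rfl⟩
  · rintro ⟨rfl, rfl, rfl, rfl, rfl⟩
    obtain ⟨a, b, c⟩ := key.2 ⟨rfl, rfl, rfl⟩
    obtain ⟨d, e⟩ := (reduced_iff hN _ _).2 ⟨rfl, rfl⟩
    exact ⟨a, b, c, (flux2_iff θ _ _).2 d, (flux1_iff hθ κ _ _).2 e⟩

/-- The amplitude `p` multiplied by `θ`, which extends continuously to `θ = 0`. -/
def scaledP (κ θ : ℝ) : Fin 3 → ℝ :=
  ![(6 * θ ^ 2 - θ * (1 + θ)) / redDet θ κ,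
    (18 * θ ^ 2 - 12 * κ - θ * (1 + θ)) / redDet θ κ,
    (6 * θ - θ * (1 + θ)) / redDet θ κ]

lemma mul_ampP {θ : ℝ} (hθ : θ ≠ 0) (κ : ℝ) (j : Fin 3) :
    θ * ampP θ κ j = scaledP κ θ j := by
  fin_cases j <;> simp [ampP, scaledP, fluxRhs] <;> field_simp <;> ring

lemma continuousAt_scaledP (κ : ℝ) (j : Fin 3) :
    ContinuousAt (fun θ => scaledP κ θ j) 0 := by
  have hN : redDet 0 κ ≠ 0 := by norm_num [redDet]
  have hc : ContinuousAt (fun θ => redDet θ κ) 0 := by unfold redDet; fun_prop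
  fin_cases j <;> simp only [scaledP] <;> exact ContinuousAt.div (by fun_prop) hc hN

/-- The second row of the field in the third phase, multiplied by `θ / 2`. -/
def scaledRow (κ θ : ℝ) (j : Fin 3) : ℝ :=
  (θ * ![0, 1, 0] j - (1 - θ) * θ * scaledP κ θ j -
    (θ - (1 - θ ^ 2) * scaledP κ θ j) / 6) / 2

lemma scaled_form_eq {θ : ℝ} (hθ : θ ≠ 0) (κ : ℝ) :
    (θ / 2) • ((field2 θ (ampP θ κ) (-ampQ θ κ))ᵀ * Jmat * field2 θ (ampP θ κ) (-ampQ θ κ)) =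
      !![0, -scaledRow κ θ 1, -scaledRow κ θ 2;
        scaledRow κ θ 1, 0, 0; scaledRow κ θ 2, 0, 0] := by
  simp only [scaledRow, ← mul_ampP hθ]
  ext i j
  fin_cases i <;> fin_cases j <;>
    simp [Matrix.mul_apply, Fin.sum_univ_three, Jmat, field2_eq, ampQ, -mul_eq_zero, -cons_mul] <;>
    ring

lemma tendsto_scaledRow (κ : ℝ) (j : Fin 3) :
    Tendsto (fun θ => scaledRow κ θ j) (𝓝[>] 0) (𝓝 (scaledRow κ 0 j)) := by
  have h := continuousAt_scaledP κ j
  have : ContinuousAt (fun θ => scaledRow κ θ j) 0 := by unfold scaledRow; fun_prop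
  exact this.tendsto.mono_left nhdsWithin_le_nhds

theorem stmt_2 (κ : ℝ) (hκ : 0 < κ) :
    ∃ θ₀ > (0 : ℝ), ∃ E1 E2 E3 : ℝ → Matrix (Fin 3) (Fin 3) ℝ,
      ∃ η1 η2 : ℝ → (Fin 3 → ℝ),
      (∀ θ ∈ Set.Ioo 0 θ₀,
        LamSys θ κ sig3 (E1 θ) (E2 θ) (E3 θ) (η1 θ) (η2 θ) ∧
        ∀ F1 F2 F3 ζ1 ζ2, LamSys θ κ sig3 F1 F2 F3 ζ1 ζ2 →
          F1 = E1 θ ∧ F2 = E2 θ ∧ F3 = E3 θ ∧ ζ1 = η1 θ ∧ ζ2 = η2 θ) ∧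
      Filter.Tendsto (fun θ => (θ / 2) • ((E3 θ)ᵀ * Jmat * E3 θ))
        (nhdsWithin 0 (Set.Ioi 0)) (nhds (-(κ / 17) • Jmat)) := by
  refine ⟨1, one_pos, fun θ => field1 θ (ampP θ κ), fun θ => field2 θ (ampP θ κ) (ampQ θ κ),
    fun θ => field2 θ (ampP θ κ) (-ampQ θ κ), fun θ => √(1 + θ ^ 2) • ampP θ κ,
    fun θ => (2 * √2) • ampQ θ κ, ?_, ?_⟩
  · rintro θ ⟨h0, h1⟩
    have hN := (redDet_pos hκ h0 h1).ne'
    exact ⟨(lamSys_iff h0 hN _ _ _ _ _).2 ⟨rfl, rfl, rfl, rfl, rfl⟩,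
      fun F1 F2 F3 ζ1 ζ2 h => (lamSys_iff h0 hN _ _ _ _ _).1 h⟩
  · refine Tendsto.congr' (f₁ := fun θ => !![0, -scaledRow κ θ 1, -scaledRow κ θ 2;
        scaledRow κ θ 1, 0, 0; scaledRow κ θ 2, 0, 0]) ?_ ?_
    · filter_upwards [self_mem_nhdsWithin] with θ hθ
      exact (scaled_form_eq (ne_of_gt hθ) κ).symm
    · have e : -(κ / 17) • Jmat = !![0, -scaledRow κ 0 1, -scaledRow κ 0 2;
          scaledRow κ 0 1, 0, 0; scaledRow κ 0 2, 0, 0] := by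
        ext i j
        fin_cases i <;> fin_cases j <;>
          simp [Jmat, scaledRow, scaledP, redDet] <;> ring
      rw [e]
      have h1 := tendsto_scaledRow κ 1
      have h2 := tendsto_scaledRow κ 2
      refine tendsto_pi_nhds.2 fun i => tendsto_pi_nhds.2 fun j => ?_
      fin_cases i <;> fin_cases j <;>
        first
        | exact tendsto_const_nhds
        | exact h1
        | exact h2
        | exact h1.neg
        | exact h2.neg
end
end

section
/- For every κ > 0 there exists θ₀ > 0 such that for every θ ∈ (0, θ₀) the linear system (i)–(v) with σ³ equal to the matrix with rows (2, −1, 0), (1, 2, 0), (0, 0, 1/2) has a unique solution (E¹_{θ,κ}, E²_{θ,κ}, E³_{θ,κ}, η₁, η₂), and the limit as θ → 0⁺ of the matrix (θ/2) (E³_{θ,κ})ᵀ J E³_{θ,κ} equals (κ/13) J. -/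
open Matrix

noncomputable section

/-- The alternative third phase with rows `(2, -1, 0)`, `(1, 2, 0)`, `(0, 0, 1/2)`. -/
def sig3' : Matrix (Fin 3) (Fin 3) ℝ := !![2, -1, 0; 1, 2, 0; 0, 0, 1 / 2]

/-- The determinant of the reduced two-by-two system for the rescaled amplitudes. -/
def reducedDet (θ κ : ℝ) : ℝ :=
  θ * (κ + 1) + 1 / 2 * (1 - θ) * (3 * θ ^ 2 + 3 / 2) - 1 / 9 * (1 / 2 - θ) ^ 2 * (1 - θ)

/-- The rescaled first amplitude, `η₁ / √(1 + θ²)`. -/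
def amp1 (θ κ : ℝ) : Fin 3 → ℝ :=
  ![(θ / 2 + (1 / 2 - θ) / 9) / reducedDet θ κ,
    (-(κ / θ) + 3 * θ / 2 + (1 / 2 - θ) / 9) / reducedDet θ κ,
    (-(1 / 4) - (1 / 2 - θ) / 18) / reducedDet θ κ]

/-- The rescaled second amplitude, `η₂ / √2`. -/
def amp2 (θ κ : ℝ) : Fin 3 → ℝ := fun j =>
  4 / 9 * ((1 - θ) * (1 / 2 - θ) * amp1 θ κ j - ![-1, -1, 1 / 2] j)

/-- The field in the third phase with rescaled amplitudes `A` and `B`. -/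
def field3 (θ : ℝ) (A B : Fin 3 → ℝ) : Matrix (Fin 3) (Fin 3) ℝ :=
  1 - (1 - θ) • vecMulVec ![0, θ, 1] A - (1 / 2 : ℝ) • vecMulVec ![0, 1, 1] B

theorem reducedDet_pos {θ κ : ℝ} (hκ : 0 < κ) (h0 : 0 < θ) (h1 : θ < 1) :
    0 < reducedDet θ κ := by
  have h2 : 0 < 1 - θ := by linarith
  have h3 : 0 < θ * (κ + 1) := by positivity
  have h4 : 0 < 1 / 2 * (3 * θ ^ 2 + 3 / 2) - 1 / 9 * (1 / 2 - θ) ^ 2 := by nlinarith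
  have h5 := mul_pos h2 h4
  unfold reducedDet
  nlinarith

theorem vecMulVec_xi1 (θ : ℝ) (A : Fin 3 → ℝ) :
    vecMulVec (xi1 θ) (√(1 + θ ^ 2) • A) = vecMulVec ![0, θ, 1] A := by
  have hs : √(1 + θ ^ 2) ≠ 0 := by positivity
  ext i j
  fin_cases i <;> simp [xi1, vecMulVec_apply] <;> field_simp

theorem vecMulVec_xi2 (B : Fin 3 → ℝ) :
    vecMulVec xi2 (√2 • B) = vecMulVec ![0, 1, 1] B := by
  ext i j
  fin_cases i <;> simp [xi2, vecMulVec_apply]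

theorem mulVec_xi1_eq_zero_iff (θ : ℝ) (M : Matrix (Fin 3) (Fin 3) ℝ) :
    M *ᵥ xi1 θ = 0 ↔ M *ᵥ ![0, θ, 1] = 0 := by
  have hs : (√(1 + θ ^ 2))⁻¹ ≠ 0 := by positivity
  have h : xi1 θ = (√(1 + θ ^ 2))⁻¹ • ![0, θ, 1] := by
    ext i
    fin_cases i <;> simp [xi1, div_eq_inv_mul]
  rw [h, mulVec_smul, smul_eq_zero_iff_right hs]

theorem mulVec_xi2_eq_zero_iff (M : Matrix (Fin 3) (Fin 3) ℝ) :
    M *ᵥ xi2 = 0 ↔ M *ᵥ ![0, 1, 1] = 0 := by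
  have hs : (√2)⁻¹ ≠ 0 := by positivity
  have h : xi2 = (√2)⁻¹ • ![0, 1, 1] := by
    ext i
    fin_cases i <;> simp [xi2]
  rw [h, mulVec_smul, smul_eq_zero_iff_right hs]

theorem average_iff (θ : ℝ) (E1 E2 E3 P Q : Matrix (Fin 3) (Fin 3) ℝ) :
    ((1 - θ) • E1 + (θ / 2) • (E2 + E3) = 1 ∧ E2 - E3 = Q ∧ E1 - (1 / 2 : ℝ) • (E2 + E3) = P) ↔
      E1 = 1 + θ • P ∧ E2 = 1 - (1 - θ) • P + (1 / 2 : ℝ) • Q ∧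
        E3 = 1 - (1 - θ) • P - (1 / 2 : ℝ) • Q := by
  constructor
  · rintro ⟨h, rfl, rfl⟩
    refine ⟨?_, ?_, ?_⟩ <;> rw [← h] <;> module
  · rintro ⟨rfl, rfl, rfl⟩
    refine ⟨?_, ?_, ?_⟩ <;> module

theorem flux_iff {θ κ : ℝ} (hκ : 0 < κ) (h0 : 0 < θ) (h1 : θ < 1) (A B : Fin 3 → ℝ)
    (E1 E2 E3 : Matrix (Fin 3) (Fin 3) ℝ)
    (hE1 : E1 = 1 + θ • vecMulVec ![0, θ, 1] A)
    (hE2 : E2 = 1 - (1 - θ) • vecMulVec ![0, θ, 1] A + (1 / 2 : ℝ) • vecMulVec ![0, 1, 1] B)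
    (hE3 : E3 = field3 θ A B) :
    ((sig2 * E2 - sig3' * E3)ᵀ *ᵥ ![0, 1, 1] = 0 ∧
      (sig1 θ κ * E1 - (1 / 2 : ℝ) • (sig2 * E2 + sig3' * E3))ᵀ *ᵥ ![0, θ, 1] = 0) ↔
      A = amp1 θ κ ∧ B = amp2 θ κ := by
  have hD := (reducedDet_pos hκ h0 h1).ne'
  have hθ := h0.ne'
  have key : ((sig2 * E2 - sig3' * E3)ᵀ *ᵥ ![0, 1, 1] = 0 ∧
      (sig1 θ κ * E1 - (1 / 2 : ℝ) • (sig2 * E2 + sig3' * E3))ᵀ *ᵥ ![0, θ, 1] = 0) ↔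
      ∀ j, ![-1, -1, 1 / 2] j - (1 - θ) * (1 / 2 - θ) * A j + 9 / 4 * B j = 0 ∧
        ![-(θ / 2), κ / θ - 3 * θ / 2, 1 / 4] j
          + (θ * (κ + 1) + 1 / 2 * (1 - θ) * (3 * θ ^ 2 + 3 / 2)) * A j
          - 1 / 4 * (1 / 2 - θ) * B j = 0 := by
    rw [funext_iff, funext_iff, ← forall_and]
    refine forall_congr' fun j => ?_
    subst hE1 hE2 hE3
    refine and_congr (Eq.congr ?_ rfl) (Eq.congr ?_ rfl) <;> fin_cases j <;>
      simp [-cons_vecMulVec, -cons_mul, field3, sig1, sig2, sig3', mulVec, dotProduct,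
        Fin.sum_univ_three, mul_apply,
        vecMulVec_apply, one_apply] <;> field_simp <;> ring
  have hA : ∀ j, amp1 θ κ j * reducedDet θ κ =
      -![-(θ / 2), κ / θ - 3 * θ / 2, 1 / 4] j
        - 1 / 9 * (1 / 2 - θ) * ![-1, -1, 1 / 2] j := by
    intro j
    fin_cases j <;> simp [amp1, hD] <;> ring
  rw [key, funext_iff, funext_iff, ← forall_and]
  refine forall_congr' fun j => ?_
  have hj := hA j
  constructor
  · rintro ⟨h4, h5⟩
    have h : A j = amp1 θ κ j := by
      apply mul_right_cancel₀ hD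
      rw [hj]
      unfold reducedDet
      linear_combination h5 + 1 / 9 * (1 / 2 - θ) * h4
    refine ⟨h, ?_⟩
    unfold amp2
    rw [← h]
    linear_combination 4 / 9 * h4
  · rintro ⟨h, h'⟩
    rw [h, h']
    unfold amp2
    refine ⟨by ring, ?_⟩
    unfold reducedDet at hj
    linear_combination hj

theorem lamSys_iff_s3 {θ κ : ℝ} (hκ : 0 < κ) (h0 : 0 < θ) (h1 : θ < 1)
    (E1 E2 E3 : Matrix (Fin 3) (Fin 3) ℝ) (A B : Fin 3 → ℝ) :
    LamSys θ κ sig3' E1 E2 E3 (√(1 + θ ^ 2) • A) (√2 • B) ↔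
      (E1 = 1 + θ • vecMulVec ![0, θ, 1] A ∧
        E2 = 1 - (1 - θ) • vecMulVec ![0, θ, 1] A + (1 / 2 : ℝ) • vecMulVec ![0, 1, 1] B ∧
        E3 = field3 θ A B) ∧ A = amp1 θ κ ∧ B = amp2 θ κ := by
  unfold LamSys
  rw [vecMulVec_xi1, vecMulVec_xi2, mulVec_xi1_eq_zero_iff, mulVec_xi2_eq_zero_iff]
  have h := average_iff θ E1 E2 E3 (vecMulVec ![0, θ, 1] A) (vecMulVec ![0, 1, 1] B)
  constructor
  · rintro ⟨e1, e2, e3, e4, e5⟩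
    obtain ⟨f1, f2, f3⟩ := h.1 ⟨e1, e2, e3⟩
    exact ⟨⟨f1, f2, f3⟩, (flux_iff hκ h0 h1 A B E1 E2 E3 f1 f2 f3).1 ⟨e4, e5⟩⟩
  · rintro ⟨⟨f1, f2, f3⟩, hAB⟩
    obtain ⟨e1, e2, e3⟩ := h.2 ⟨f1, f2, f3⟩
    obtain ⟨e4, e5⟩ := (flux_iff hκ h0 h1 A B E1 E2 E3 f1 f2 f3).2 hAB
    exact ⟨e1, e2, e3, e4, e5⟩

theorem field3_conj_Jmat (θ : ℝ) (A B : Fin 3 → ℝ) :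
    (field3 θ A B)ᵀ * Jmat * field3 θ A B =
      !![0, -(1 - (1 - θ) * θ * A 1 - B 1 / 2), (1 - θ) * θ * A 2 + B 2 / 2;
        1 - (1 - θ) * θ * A 1 - B 1 / 2, 0, 0;
        -((1 - θ) * θ * A 2 + B 2 / 2), 0, 0] := by
  ext i j
  fin_cases i <;> fin_cases j <;>
    simp [-cons_vecMulVec, -cons_mul, field3, Jmat, mul_apply, Fin.sum_univ_three,
      vecMulVec_apply, one_apply] <;> ring

theorem tendsto_field3_conj_Jmat (κ : ℝ) :
    Filter.Tendsto
      (fun θ => (θ / 2) • ((field3 θ (amp1 θ κ) (amp2 θ κ))ᵀ * Jmat *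
        field3 θ (amp1 θ κ) (amp2 θ κ)))
      (nhdsWithin 0 (Set.Ioi 0)) (nhds ((κ / 13) • Jmat)) := by
  have hD0 : reducedDet 0 κ = 13 / 18 := by norm_num [reducedDet]
  have hDc : ContinuousAt (fun θ => reducedDet θ κ) 0 := by
    unfold reducedDet
    fun_prop
  have hne : reducedDet 0 κ ≠ 0 := by rw [hD0]; norm_num
  set u : ℝ → ℝ := fun θ => 1 / 2 * (θ - 2 / 9 * θ -
    ((1 - θ) * θ + 2 / 9 * (1 - θ) * (1 / 2 - θ)) *
      ((-κ + θ * (3 * θ / 2 + (1 / 2 - θ) / 9)) / reducedDet θ κ)) with hu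
  set v : ℝ → ℝ := fun θ => θ / 2 * (((1 - θ) * θ + 2 / 9 * (1 - θ) * (1 / 2 - θ)) *
    ((-(1 / 4) - (1 / 2 - θ) / 18) / reducedDet θ κ) - 1 / 9) with hv
  have hut : Filter.Tendsto u (nhdsWithin 0 (Set.Ioi 0)) (nhds (κ / 13)) := by
    have hc : ContinuousAt u 0 := by fun_prop (disch := exact hne)
    have h0 : u 0 = κ / 13 := by simp only [hu, hD0]; ring
    exact h0 ▸ hc.tendsto.mono_left nhdsWithin_le_nhds
  have hvt : Filter.Tendsto v (nhdsWithin 0 (Set.Ioi 0)) (nhds 0) := by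
    have hc : ContinuousAt v 0 := by fun_prop (disch := exact hne)
    have h0 : v 0 = 0 := by simp [hv]
    simpa only [h0] using hc.tendsto.mono_left nhdsWithin_le_nhds
  have hlim : Filter.Tendsto (fun θ => !![0, -u θ, v θ; u θ, 0, 0; -v θ, 0, 0])
      (nhdsWithin 0 (Set.Ioi 0)) (nhds ((κ / 13) • Jmat)) := by
    refine tendsto_pi_nhds.2 fun i => tendsto_pi_nhds.2 fun j => ?_
    fin_cases i <;> fin_cases j <;> simp [Jmat]
    · exact hut
    · exact hvt
    · exact hut
    · simpa using hvt.neg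
  refine hlim.congr' ?_
  filter_upwards [self_mem_nhdsWithin] with θ hθ
  have hθ' : θ ≠ 0 := (Set.mem_Ioi.1 hθ).ne'
  have e1 : θ / 2 * (1 - (1 - θ) * θ * amp1 θ κ 1 - amp2 θ κ 1 / 2) = u θ := by
    have h : (-κ + θ * (3 * θ / 2 + (1 / 2 - θ) / 9)) / reducedDet θ κ = θ * amp1 θ κ 1 := by
      simp only [amp1, cons_val_one, cons_val_zero]
      rw [← mul_div_assoc]
      congr 1
      field_simp
      ring
    simp only [hu, h, amp2, cons_val_one, cons_val_zero]
    ring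
  have e2 : θ / 2 * ((1 - θ) * θ * amp1 θ κ 2 + amp2 θ κ 2 / 2) = v θ := by
    simp only [hv, amp2, amp1, cons_val]
    ring
  rw [field3_conj_Jmat]
  ext i j
  fin_cases i <;> fin_cases j <;> simp [-neg_sub, -neg_add_rev, ← e1, ← e2]

theorem stmt_3 (κ : ℝ) (hκ : 0 < κ) :
    ∃ θ₀ > (0 : ℝ), ∃ E1 E2 E3 : ℝ → Matrix (Fin 3) (Fin 3) ℝ,
      ∃ η1 η2 : ℝ → (Fin 3 → ℝ),
      (∀ θ ∈ Set.Ioo 0 θ₀,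
        LamSys θ κ sig3' (E1 θ) (E2 θ) (E3 θ) (η1 θ) (η2 θ) ∧
        ∀ F1 F2 F3 ζ1 ζ2, LamSys θ κ sig3' F1 F2 F3 ζ1 ζ2 →
          F1 = E1 θ ∧ F2 = E2 θ ∧ F3 = E3 θ ∧ ζ1 = η1 θ ∧ ζ2 = η2 θ) ∧
      Filter.Tendsto (fun θ => (θ / 2) • ((E3 θ)ᵀ * Jmat * E3 θ))
        (nhdsWithin 0 (Set.Ioi 0)) (nhds ((κ / 13) • Jmat)) := by
  refine ⟨1, one_pos, fun θ => 1 + θ • vecMulVec ![0, θ, 1] (amp1 θ κ),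
    fun θ => 1 - (1 - θ) • vecMulVec ![0, θ, 1] (amp1 θ κ) +
      (1 / 2 : ℝ) • vecMulVec ![0, 1, 1] (amp2 θ κ),
    fun θ => field3 θ (amp1 θ κ) (amp2 θ κ), fun θ => √(1 + θ ^ 2) • amp1 θ κ,
    fun θ => √2 • amp2 θ κ, ?_, tendsto_field3_conj_Jmat κ⟩
  rintro θ ⟨h0, h1⟩
  refine ⟨(lamSys_iff_s3 hκ h0 h1 _ _ _ _ _).2 ⟨⟨rfl, rfl, rfl⟩, rfl, rfl⟩, ?_⟩
  intro F1 F2 F3 ζ1 ζ2 h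
  obtain ⟨A, rfl⟩ : ∃ A, ζ1 = √(1 + θ ^ 2) • A :=
    ⟨(√(1 + θ ^ 2))⁻¹ • ζ1, (smul_inv_smul₀ (by positivity) ζ1).symm⟩
  obtain ⟨B, rfl⟩ : ∃ B, ζ2 = √2 • B :=
    ⟨(√2)⁻¹ • ζ2, (smul_inv_smul₀ (by positivity) ζ2).symm⟩
  obtain ⟨⟨f1, f2, f3⟩, rfl, rfl⟩ := (lamSys_iff_s3 hκ h0 h1 _ _ _ _ _).1 h
  exact ⟨f1, f2, f3, rfl, rfl⟩
end
end

section
/- The 6×6 matrix M − L_* is positive semidefinite if and only if the following five inequalities hold: 1/b_* ≤ h, b_* ≤ m, a_* ≥ a_L, a_* + c_*²/a_* ≤ d_L + c_L²/a_L, and (c_L/a_L − c_*/a_*)² ≤ (1/a_L − 1/a_*)(d_L + c_L²/a_L − a_* − c_*²/a_*). -/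
theorem Lmat6_sub (p q r s t p₀ q₀ r₀ s₀ t₀ : ℝ) :
    Lmat6 p q r s t - Lmat6 p₀ q₀ r₀ s₀ t₀ =
      Lmat6 (p - p₀) (q - q₀) (r - r₀) (s - s₀) (t - t₀) := by
  ext i j
  fin_cases i <;> fin_cases j <;> simp [Lmat6, neg_add_eq_sub]

theorem Lmat6_isHermitian (p q r s t : ℝ) : (Lmat6 p q r s t).IsHermitian := by
  ext i j
  fin_cases i <;> fin_cases j <;> simp [Lmat6]

theorem dotProduct_Lmat6_mulVec (p q r s t : ℝ) (x : Fin 6 → ℝ) :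
    star x ⬝ᵥ (Lmat6 p q r s t).mulVec x =
      (p * x 0 ^ 2 + 2 * t * x 0 * x 4 + r * x 4 ^ 2)
        + (p * x 1 ^ 2 + 2 * (-t) * x 1 * x 3 + r * x 3 ^ 2)
        + q * x 2 ^ 2 + s * x 5 ^ 2 := by
  simp [Lmat6, Matrix.mulVec, dotProduct, Fin.sum_univ_succ]
  ring

theorem binary_quadratic_form_nonneg {p r t : ℝ} (hp : 0 ≤ p) (hr : 0 ≤ r)
    (ht : t ^ 2 ≤ p * r) (x y : ℝ) : 0 ≤ p * x ^ 2 + 2 * t * x * y + r * y ^ 2 := by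
  rcases hp.eq_or_lt with rfl | hp
  · have : t = 0 := by
      rw [zero_mul] at ht
      exact pow_eq_zero_iff two_ne_zero |>.1 (le_antisymm ht (sq_nonneg t))
    subst this
    have := mul_nonneg hr (sq_nonneg y)
    linarith
  · refine nonneg_of_mul_nonneg_right ?_ hp
    have := mul_nonneg (sub_nonneg.2 ht) (sq_nonneg y)
    linear_combination sq_nonneg (p * x + t * y) + this

theorem Lmat6_posSemidef_iff (p q r s t : ℝ) :
    (Lmat6 p q r s t).PosSemidef ↔ 0 ≤ q ∧ 0 ≤ s ∧ 0 ≤ p ∧ 0 ≤ r ∧ t ^ 2 ≤ p * r := by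
  simp only [Matrix.posSemidef_iff_dotProduct_mulVec, dotProduct_Lmat6_mulVec,
    Lmat6_isHermitian, true_and]
  constructor
  · intro H
    refine ⟨by simpa using H ![0, 0, 1, 0, 0, 0], by simpa using H ![0, 0, 0, 0, 0, 1],
      by simpa using H ![1, 0, 0, 0, 0, 0], by simpa using H ![0, 0, 0, 0, 1, 0], ?_⟩
    have hd : discrim p (2 * t) r ≤ 0 := discrim_le_zero fun x => by
      have := H ![x, 0, 0, 0, 1, 0]
      simp at this
      linarith
    rw [discrim] at hd
    linarith
  · rintro ⟨hq, hs, hp, hr, ht⟩ x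
    have h₁ := binary_quadratic_form_nonneg hp hr ht (x 0) (x 4)
    have h₂ := binary_quadratic_form_nonneg hp hr ((neg_sq t).trans_le ht) (x 1) (x 3)
    positivity

theorem stmt_5 (aL dL astar bstar h m cL cstar : ℝ)
    (haL : 0 < aL) (hdL : 0 < dL) (hastar : 0 < astar) (hbstar : 0 < bstar)
    (hh : 0 < h) (hm : 0 < m) :
    (Lmat6 (1 / aL) h (dL + cL ^ 2 / aL) m (cL / aL)
        - Lmat6 (1 / astar) (1 / bstar) (astar + cstar ^ 2 / astar) bstar
            (cstar / astar)).PosSemidef ↔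
      (1 / bstar ≤ h ∧ bstar ≤ m ∧ aL ≤ astar ∧
        astar + cstar ^ 2 / astar ≤ dL + cL ^ 2 / aL ∧
        (cL / aL - cstar / astar) ^ 2 ≤
          (1 / aL - 1 / astar) * (dL + cL ^ 2 / aL - astar - cstar ^ 2 / astar)) := by
  rw [Lmat6_sub, Lmat6_posSemidef_iff, sub_nonneg, sub_nonneg, sub_nonneg, sub_nonneg,
    one_div_le_one_div hastar haL, sub_sub _ astar]
end

section
/- Let σ be a real 3×3 matrix whose symmetric part σ^S := (σ + σᵀ)/2 is invertible, and let σ^A := (σ − σᵀ)/2. Let e, e′ ∈ ℝ³ and set j := σe, j′ := σᵀe′, e_S := (e+e′)/2, e_A := (e−e′)/2, j_S := (j+j′)/2, j_A := (j−j′)/2. Let L be the 6×6 block matrix with blocks L = [[(σ^S)⁻¹, −(σ^S)⁻¹σ^A], [σ^A(σ^S)⁻¹, σ^S − σ^A(σ^S)⁻¹σ^A]]. Then the vector (e_S, j_A) ∈ ℝ⁶ equals L applied to the vector (j_S, e_A) ∈ ℝ⁶. -/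
open Matrix

theorem stmt_9 (σ : Matrix (Fin 3) (Fin 3) ℝ)
    (hinv : IsUnit ((1 / 2 : ℝ) • (σ + σᵀ)))
    (e e' : Fin 3 → ℝ) :
    let σS := (1 / 2 : ℝ) • (σ + σᵀ)
    let σA := (1 / 2 : ℝ) • (σ - σᵀ)
    let j := σ *ᵥ e
    let j' := σᵀ *ᵥ e'
    let eS := (1 / 2 : ℝ) • (e + e')
    let eA := (1 / 2 : ℝ) • (e - e')
    let jS := (1 / 2 : ℝ) • (j + j')
    let jA := (1 / 2 : ℝ) • (j - j')
    let L := Matrix.fromBlocks σS⁻¹ (-(σS⁻¹ * σA)) (σA * σS⁻¹) (σS - σA * σS⁻¹ * σA)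
    Sum.elim eS jA = L *ᵥ Sum.elim jS eA := by
  intro σS σA j j' eS eA jS jA L
  have hσ : σ = σS + σA := by
    simp only [σS, σA]
    module
  have hσT : σᵀ = σS - σA := by
    simp only [σS, σA]
    module
  have hjS : jS = σS *ᵥ eS + σA *ᵥ eA := by
    simp only [jS, j, j', hσT]
    rw [hσ]
    simp only [eS, eA, add_mulVec, sub_mulVec, mulVec_add, mulVec_sub, mulVec_smul]
    module
  have hjA : jA = σS *ᵥ eA + σA *ᵥ eS := by
    simp only [jA, j, j', hσT]
    rw [hσ]
    simp only [eS, eA, add_mulVec, sub_mulVec, mulVec_add, mulVec_sub, mulVec_smul]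
    module
  have heS : σS⁻¹ *ᵥ jS = eS + σS⁻¹ *ᵥ (σA *ᵥ eA) := by
    rw [hjS, mulVec_add, mulVec_mulVec, nonsing_inv_mul σS ((isUnit_iff_isUnit_det σS).mp hinv),
      one_mulVec]
  simp only [L, fromBlocks_mulVec, Sum.elim_comp_inl, Sum.elim_comp_inr, neg_mulVec, sub_mulVec,
    ← mulVec_mulVec, heS, mulVec_add, hjA]
  congr 1 <;> abel
end
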